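/- arXiv:1510.09038 — 11 statements merged into one kernel-verified Lean document; each statement's English description precedes it below -/
import Mathlib

section
/- Let f, η, q : ℝ → ℝ be differentiable functions with q′(u) = η′(u)·f′(u) for all u, let v := η′ be the entropy variable and Ψ(u) := v(u)·f(u) − q(u) the entropy potential. Let F* : ℝ × ℝ → ℝ satisfy the entropy conservation condition (v(b) − v(a))·F*(a,b) = Ψ(b) − Ψ(a) for all a, b. Fix h > 0 and let u : ℝ → ℤ → ℝ be such that for each i ∈ ℤ the map t ↦ u(t)(i) is differentiable and satisfies the semi-discrete scheme d/dt u(t)(i) = −(F*(u(t)(i), u(t)(i+1)) − F*(u(t)(i−1), u(t)(i)))/h. Then for every i ∈ ℤ and every t, d/dt η(u(t)(i)) + (q*(u(t)(i), u(t)(i+1)) − q*(u(t)(i−1), u(t)(i)))/h = 0, where q*(a,b) := ((v(a)+v(b))/2)·F*(a,b) − (Ψ(a)+Ψ(b))/2. -/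
/-- **Tadmor's theorem on entropy conservative schemes.**
Let `f, η, q : ℝ → ℝ` be differentiable with `q' = η'·f'`, let `v := η'` be the entropy
variable and `Ψ := v·f − q` the entropy potential.  If the two-point flux `F*` satisfies
the entropy conservation condition `(v(b) − v(a))·F*(a,b) = Ψ(b) − Ψ(a)`, then any solution
of the semi-discrete scheme `d/dt uᵢ = −(F*(uᵢ,uᵢ₊₁) − F*(uᵢ₋₁,uᵢ))/h` satisfies the
discrete entropy equality `d/dt η(uᵢ) + (q*ᵢ₊₁⸝₂ − q*ᵢ₋₁⸝₂)/h = 0` with the numerical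
entropy flux `q*(a,b) = ((v(a)+v(b))/2)·F*(a,b) − (Ψ(a)+Ψ(b))/2`. -/
theorem entropy_conservative_scheme
    (f η q : ℝ → ℝ)
    (hf : Differentiable ℝ f) (hη : Differentiable ℝ η) (hq : Differentiable ℝ q)
    (hqf : ∀ u : ℝ, deriv q u = deriv η u * deriv f u)
    (v : ℝ → ℝ) (hv : v = deriv η)
    (Ψ : ℝ → ℝ) (hΨ : ∀ u : ℝ, Ψ u = v u * f u - q u)
    (Fs : ℝ → ℝ → ℝ)
    (hFs : ∀ a b : ℝ, (v b - v a) * Fs a b = Ψ b - Ψ a)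
    (h : ℝ) (hh : 0 < h)
    (u : ℝ → ℤ → ℝ)
    (hu : ∀ i : ℤ, Differentiable ℝ (fun t => u t i))
    (hscheme : ∀ (t : ℝ) (i : ℤ), deriv (fun s => u s i) t =
      -(Fs (u t i) (u t (i+1)) - Fs (u t (i-1)) (u t i)) / h)
    (qs : ℝ → ℝ → ℝ)
    (hqs : ∀ a b : ℝ, qs a b = ((v a + v b) / 2) * Fs a b - (Ψ a + Ψ b) / 2) :
    ∀ (i : ℤ) (t : ℝ),
      deriv (fun s => η (u s i)) t +
        (qs (u t i) (u t (i+1)) - qs (u t (i-1)) (u t i)) / h = 0 := by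
  intro i t
  have hchain : deriv (fun s => η (u s i)) t = v (u t i) * deriv (fun s => u s i) t := by
    rw [hv]
    exact ((hη (u t i)).hasDerivAt.comp t (hu i t).hasDerivAt).deriv
  have hflux : qs (u t i) (u t (i+1)) - qs (u t (i-1)) (u t i) =
      v (u t i) * (Fs (u t i) (u t (i+1)) - Fs (u t (i-1)) (u t i)) := by
    rw [hqs, hqs]
    linear_combination (hFs (u t i) (u t (i+1)) + hFs (u t (i-1)) (u t i)) / 2
  rw [hchain, hscheme, hflux]
  ring
end

section
/- Let η : ℝ → ℝ be twice differentiable with η″(u) > 0 for all u, let f : ℝ → ℝ be differentiable, and let q : ℝ → ℝ be differentiable with q′(u) = η′(u)·f′(u) for all u. Set v := η′ and Ψ(u) := v(u)·f(u) − q(u). Then for all real a < b there exists ξ ∈ (a,b) such that Ψ(b) − Ψ(a) = f(ξ)·(v(b) − v(a)). (Consequently the unique two-point entropy conservative flux F*(a,b) = (Ψ(b) − Ψ(a))/(v(b) − v(a)) equals f(ξ) for some intermediate value ξ, so it is a consistent numerical flux.) -/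
/-- For a strictly convex twice differentiable entropy `η`, differentiable flux `f`, and
entropy flux `q` with `q' = η'·f'`, setting `v := η'` and `Ψ := v·f − q`, for all `a < b`
there exists `ξ ∈ (a,b)` with `Ψ(b) − Ψ(a) = f(ξ)·(v(b) − v(a))`.  Consequently the unique
two-point entropy conservative flux `F*(a,b) = (Ψ(b) − Ψ(a))/(v(b) − v(a))` equals `f(ξ)`
for some intermediate value `ξ`, i.e. it is a consistent numerical flux. -/
theorem entropy_conservative_flux_consistent
    (η f q : ℝ → ℝ)
    (hη : Differentiable ℝ η) (hη' : Differentiable ℝ (deriv η))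
    (hη'' : ∀ u : ℝ, 0 < deriv (deriv η) u)
    (hf : Differentiable ℝ f) (hq : Differentiable ℝ q)
    (hqf : ∀ u : ℝ, deriv q u = deriv η u * deriv f u)
    (v : ℝ → ℝ) (hv : v = deriv η)
    (Ψ : ℝ → ℝ) (hΨ : ∀ u : ℝ, Ψ u = v u * f u - q u) :
    ∀ a b : ℝ, a < b → ∃ ξ ∈ Set.Ioo a b, Ψ b - Ψ a = f ξ * (v b - v a) := by
  subst hv
  intro a b hab
  have hv (x : ℝ) : HasDerivAt (deriv η) (deriv (deriv η) x) x := (hη' x).hasDerivAt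
  have hΨ' (x : ℝ) : HasDerivAt Ψ (deriv (deriv η) x * f x) x := by
    rw [funext hΨ]
    refine (((hv x).mul (hf x).hasDerivAt).sub (hq x).hasDerivAt).congr_deriv ?_
    rw [hqf x]
    ring
  obtain ⟨ξ, hξ, h⟩ := exists_ratio_hasDerivAt_eq_ratio_slope Ψ _ hab
    (fun x _ => (hΨ' x).continuousAt.continuousWithinAt) (fun x _ => hΨ' x)
    (deriv η) _ hη'.continuous.continuousOn (fun x _ => hv x)
  refine ⟨ξ, hξ, mul_right_cancel₀ (hη'' ξ).ne' ?_⟩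
  linear_combination -h
end

section
/- Let f, η, q : ℝ → ℝ be differentiable with q′ = η′·f′, set v := η′ and Ψ := v·f − q, and let F* : ℝ × ℝ → ℝ satisfy (v(b) − v(a))·F*(a,b) = Ψ(b) − Ψ(a) for all a, b. Let a_diff : ℝ × ℝ → ℝ satisfy a_diff(a,b) ≥ 0 for all a, b, and define the entropy stable flux F(a,b) := F*(a,b) − (1/2)·a_diff(a,b)·(v(b) − v(a)). Fix h > 0 and let u : ℝ → ℤ → ℝ be such that for each i the map t ↦ u(t)(i) is differentiable and satisfies d/dt u(t)(i) = −(F(u(t)(i), u(t)(i+1)) − F(u(t)(i−1), u(t)(i)))/h. Then for every i and t the discrete entropy inequality holds: d/dt η(u(t)(i)) + (Q(u(t)(i), u(t)(i+1)) − Q(u(t)(i−1), u(t)(i)))/h ≤ 0, where Q(a,b) := ((v(a)+v(b))/2)·F*(a,b) − (Ψ(a)+Ψ(b))/2 − (1/2)·((v(a)+v(b))/2)·a_diff(a,b)·(v(b) − v(a)). -/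
/-- **Tadmor's lemma on entropy stable schemes.**
With `f, η, q` differentiable, `q' = η'·f'`, `v := η'`, `Ψ := v·f − q`, an entropy
conservative flux `F*` satisfying `(v(b) − v(a))·F*(a,b) = Ψ(b) − Ψ(a)`, and a nonnegative
diffusion coefficient `a_diff`, the entropy stable flux
`F(a,b) = F*(a,b) − (1/2)·a_diff(a,b)·(v(b) − v(a))` yields a semi-discrete scheme
satisfying the discrete entropy inequality with the numerical entropy flux
`Q(a,b) = ((v(a)+v(b))/2)·F*(a,b) − (Ψ(a)+Ψ(b))/2
          − (1/2)·((v(a)+v(b))/2)·a_diff(a,b)·(v(b) − v(a))`. -/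
theorem entropy_stable_scheme
    (f η q : ℝ → ℝ)
    (hf : Differentiable ℝ f) (hη : Differentiable ℝ η) (hq : Differentiable ℝ q)
    (hqf : ∀ u : ℝ, deriv q u = deriv η u * deriv f u)
    (v : ℝ → ℝ) (hv : v = deriv η)
    (Ψ : ℝ → ℝ) (hΨ : ∀ u : ℝ, Ψ u = v u * f u - q u)
    (Fs : ℝ → ℝ → ℝ)
    (hFs : ∀ a b : ℝ, (v b - v a) * Fs a b = Ψ b - Ψ a)
    (adiff : ℝ → ℝ → ℝ) (hadiff : ∀ a b : ℝ, 0 ≤ adiff a b)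
    (F : ℝ → ℝ → ℝ)
    (hF : ∀ a b : ℝ, F a b = Fs a b - (1/2) * adiff a b * (v b - v a))
    (h : ℝ) (hh : 0 < h)
    (u : ℝ → ℤ → ℝ)
    (hu : ∀ i : ℤ, Differentiable ℝ (fun t => u t i))
    (hscheme : ∀ (t : ℝ) (i : ℤ), deriv (fun s => u s i) t =
      -(F (u t i) (u t (i+1)) - F (u t (i-1)) (u t i)) / h)
    (Q : ℝ → ℝ → ℝ)
    (hQ : ∀ a b : ℝ, Q a b = ((v a + v b) / 2) * Fs a b - (Ψ a + Ψ b) / 2 -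
      (1/2) * ((v a + v b) / 2) * adiff a b * (v b - v a)) :
    ∀ (i : ℤ) (t : ℝ),
      deriv (fun s => η (u s i)) t +
        (Q (u t i) (u t (i+1)) - Q (u t (i-1)) (u t i)) / h ≤ 0 := by
  intro i t
  have hchain : deriv (fun s => η (u s i)) t = v (u t i) * deriv (fun s => u s i) t := by
    rw [hv]
    exact ((hη (u t i)).hasDerivAt.comp t (hu i t).hasDerivAt).deriv
  have hright : ∀ a b : ℝ, Q a b - v a * F a b = -Ψ a - adiff a b * (v b - v a) ^ 2 / 4 := by
    intro a b
    rw [hQ, hF]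
    linear_combination (1 / 2) * hFs a b
  have hleft : ∀ a b : ℝ, v b * F a b - Q a b = Ψ b - adiff a b * (v b - v a) ^ 2 / 4 := by
    intro a b
    rw [hQ, hF]
    linear_combination (1 / 2) * hFs a b
  have hdiss : ∀ a b : ℝ, 0 ≤ adiff a b * (v b - v a) ^ 2 :=
    fun a b => mul_nonneg (hadiff a b) (sq_nonneg _)
  have hcombine : deriv (fun s => η (u s i)) t +
      (Q (u t i) (u t (i+1)) - Q (u t (i-1)) (u t i)) / h =
      ((Q (u t i) (u t (i+1)) - v (u t i) * F (u t i) (u t (i+1))) +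
        (v (u t i) * F (u t (i-1)) (u t i) - Q (u t (i-1)) (u t i))) / h := by
    rw [hchain, hscheme]
    ring
  rw [hcombine, hright, hleft]
  refine div_nonpos_of_nonpos_of_nonneg ?_ hh.le
  linarith [hdiss (u t i) (u t (i+1)), hdiss (u t (i-1)) (u t i)]
end

section
/- Let f, η, q : ℝ → ℝ be differentiable with q′ = η′·f′, set v := η′ and Ψ := v·f − q, and let F* : ℝ × ℝ → ℝ satisfy (v(b) − v(a))·F*(a,b) = Ψ(b) − Ψ(a) for all a, b. Fix h > 0, let u : ℝ → ℤ → ℝ with each t ↦ u(t)(i) differentiable, let a_diff : ℝ → ℤ → ℝ be nonnegative, and let J : ℝ → ℤ → ℝ (the reconstructed interface jumps, J(t)(i) representing ⟦v⟧_{i+1/2}) satisfy the sign property J(t)(i)·(v(u(t)(i+1)) − v(u(t)(i))) ≥ 0 for all t, i, with |J(t)(i)| ≤ |v(u(t)(i+1)) − v(u(t)(i))| replaced by no size restriction. Suppose d/dt u(t)(i) = −(F(t)(i) − F(t)(i−1))/h where F(t)(i) := F*(u(t)(i), u(t)(i+1)) − (1/2)·a_diff(t)(i)·J(t)(i). Then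 for every i and t, d/dt η(u(t)(i)) + (Q(t)(i) − Q(t)(i−1))/h ≤ 0, where Q(t)(i) := ((v(u(t)(i)) + v(u(t)(i+1)))/2)·F*(u(t)(i), u(t)(i+1)) − (Ψ(u(t)(i)) + Ψ(u(t)(i+1)))/2 − (1/2)·((v(u(t)(i)) + v(u(t)(i+1)))/2)·a_diff(t)(i)·J(t)(i); that is, the scheme is entropy stable. -/
/-- **Fjordholm–Mittal–Tadmor lemma underlying the TeCNO schemes.**
With `f, η, q` differentiable, `q' = η'·f'`, `v := η'`, `Ψ := v·f − q`, an entropy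
conservative flux `F*` satisfying `(v(b) − v(a))·F*(a,b) = Ψ(b) − Ψ(a)`, nonnegative
diffusion coefficients `a_diff(t)(i) ≥ 0`, and reconstructed interface jumps `J(t)(i)`
satisfying the sign property `J(t)(i)·(v(uᵢ₊₁) − v(uᵢ)) ≥ 0` (with no size restriction on
`J`), the scheme with flux `F(t)(i) = F*(uᵢ,uᵢ₊₁) − (1/2)·a_diff(t)(i)·J(t)(i)` satisfies a
discrete entropy inequality, i.e. it is entropy stable. -/
theorem tecno_entropy_stable
    (f η q : ℝ → ℝ)
    (hf : Differentiable ℝ f) (hη : Differentiable ℝ η) (hq : Differentiable ℝ q)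
    (hqf : ∀ u : ℝ, deriv q u = deriv η u * deriv f u)
    (v : ℝ → ℝ) (hv : v = deriv η)
    (Ψ : ℝ → ℝ) (hΨ : ∀ u : ℝ, Ψ u = v u * f u - q u)
    (Fs : ℝ → ℝ → ℝ)
    (hFs : ∀ a b : ℝ, (v b - v a) * Fs a b = Ψ b - Ψ a)
    (h : ℝ) (hh : 0 < h)
    (u : ℝ → ℤ → ℝ)
    (hu : ∀ i : ℤ, Differentiable ℝ (fun t => u t i))
    (adiff : ℝ → ℤ → ℝ) (hadiff : ∀ (t : ℝ) (i : ℤ), 0 ≤ adiff t i)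
    (J : ℝ → ℤ → ℝ)
    (hsign : ∀ (t : ℝ) (i : ℤ), J t i * (v (u t (i+1)) - v (u t i)) ≥ 0)
    (F : ℝ → ℤ → ℝ)
    (hF : ∀ (t : ℝ) (i : ℤ),
      F t i = Fs (u t i) (u t (i+1)) - (1/2) * adiff t i * J t i)
    (hscheme : ∀ (t : ℝ) (i : ℤ), deriv (fun s => u s i) t =
      -(F t i - F t (i-1)) / h)
    (Q : ℝ → ℤ → ℝ)
    (hQ : ∀ (t : ℝ) (i : ℤ),
      Q t i = ((v (u t i) + v (u t (i+1))) / 2) * Fs (u t i) (u t (i+1)) -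
        (Ψ (u t i) + Ψ (u t (i+1))) / 2 -
        (1/2) * ((v (u t i) + v (u t (i+1))) / 2) * adiff t i * J t i) :
    ∀ (i : ℤ) (t : ℝ),
      deriv (fun s => η (u s i)) t + (Q t i - Q t (i-1)) / h ≤ 0 := by
  intro i t
  have hchain : deriv (fun s => η (u s i)) t = v (u t i) * (-(F t i - F t (i-1)) / h) := by
    rw [← hscheme t i, hv]
    exact ((hη (u t i)).hasDerivAt.comp t (hu i t).hasDerivAt).deriv
  have hi : i - 1 + 1 = i := by ring
  have hF' := hF t (i-1)
  have hQ' := hQ t (i-1)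
  have hsign' := hsign t (i-1)
  rw [hi] at hF' hQ' hsign'
  have hright := mul_nonneg (hadiff t i) (hsign t i)
  have hleft := mul_nonneg (hadiff t (i-1)) hsign'
  have hproduction :
      v (u t i) * (-(F t i - F t (i-1))) + (Q t i - Q t (i-1)) ≤ 0 := by
    rw [hF t i, hQ t i, hF', hQ']
    linarith [hFs (u t i) (u t (i+1)), hFs (u t (i-1)) (u t i)]
  rw [hchain, ← mul_div_assoc, ← add_div]
  exact div_nonpos_of_nonpos_of_nonneg hproduction hh.le
end

section
/- Fix real numbers v_{i−1}, v_i, v_{i+1}, v_{i+2} with Δv_{i+1/2} := v_{i+1} − v_i ≠ 0, and set θ⁺ := (v_i − v_{i−1})/Δv_{i+1/2} and θ⁻ := (v_{i+2} − v_{i+1})/Δv_{i+1/2}. Let w_0, w_1, w̃_0, w̃_1 be real weights with w_0 + w_1 = 1 and w̃_0 + w̃_1 = 1, and define the reconstructed interface values v⁻ := w_0·(v_i + v_{i+1})/2 + w_1·(3v_i − v_{i−1})/2 and v⁺ := w̃_0·(3v_{i+1} − v_{i+2})/2 + w̃_1·(v_i + v_{i+1})/2. Then the reconstructed jump satisfies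 the identity v⁺ − v⁻ = (1/2)·[w̃_0·(1 − θ⁻) + w_1·(1 − θ⁺)]·Δv_{i+1/2}. In particular, sign(v⁺ − v⁻) = sign(Δv_{i+1/2}) holds (in the weak sense (v⁺ − v⁻)·Δv_{i+1/2} ≥ 0) if and only if w̃_0·(1 − θ⁻) + w_1·(1 − θ⁺) ≥ 0. -/
/-- The jump in the third-order WENO reconstructed interface values satisfies
`v⁺ − v⁻ = (1/2)·[w̃₀·(1 − θ⁻) + w₁·(1 − θ⁺)]·Δv`, and consequently the (weak) sign
property `(v⁺ − v⁻)·Δv ≥ 0` holds if and only if `w̃₀·(1 − θ⁻) + w₁·(1 − θ⁺) ≥ 0`. -/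
theorem weno_jump_identity_and_sign_property
    (vim1 vi vip1 vip2 : ℝ) (hΔ : vip1 - vi ≠ 0)
    (w0 w1 wt0 wt1 : ℝ) (hw : w0 + w1 = 1) (hwt : wt0 + wt1 = 1)
    (Δv θp θm vm vp : ℝ)
    (hΔv : Δv = vip1 - vi)
    (hθp : θp = (vi - vim1) / Δv)
    (hθm : θm = (vip2 - vip1) / Δv)
    (hvm : vm = w0 * (vi + vip1) / 2 + w1 * (3 * vi - vim1) / 2)
    (hvp : vp = wt0 * (3 * vip1 - vip2) / 2 + wt1 * (vi + vip1) / 2) :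
    vp - vm = (1/2) * (wt0 * (1 - θm) + w1 * (1 - θp)) * Δv ∧
      ((vp - vm) * Δv ≥ 0 ↔ wt0 * (1 - θm) + w1 * (1 - θp) ≥ 0) := by
  have hne : Δv ≠ 0 := hΔv ▸ hΔ
  have hp : θp * Δv = vi - vim1 := by rw [hθp, div_mul_cancel₀ _ hne]
  have hm : θm * Δv = vip2 - vip1 := by rw [hθm, div_mul_cancel₀ _ hne]
  have hjump : vp - vm = (1/2) * (wt0 * (1 - θm) + w1 * (1 - θp)) * Δv := by
    rw [hvp, hvm]
    linear_combination (wt0 / 2) * hm + (w1 / 2) * hp - (wt0 + w1) / 2 * hΔv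
      + (vi + vip1) / 2 * hwt - (vi + vip1) / 2 * hw
  refine ⟨hjump, ?_⟩
  have hprod : (vp - vm) * Δv = (wt0 * (1 - θm) + w1 * (1 - θp)) * (Δv ^ 2 / 2) := by
    rw [hjump]
    ring
  have hpos : 0 < Δv ^ 2 / 2 := by positivity
  rw [hprod]
  exact mul_nonneg_iff_of_pos_right hpos
end

section
/- Fix real numbers v_{i−1}, v_i, v_{i+1}. Let w_0, w_1 (weights at interface i+1/2) and w̃_0', w̃_1' (right weights at interface i−1/2) be reals with w_0 + w_1 = 1 and w̃_0' + w̃_1' = 1, and define v⁻_{i+1/2} := w_0·(v_i + v_{i+1})/2 + w_1·(3v_i − v_{i−1})/2 and v⁺_{i−1/2} := w̃_0'·(3v_i − v_{i+1})/2 + w̃_1'·(v_{i−1} + v_i)/2. Then the inner difference satisfies the identity v⁻_{i+1/2} − v⁺_{i−1/2} = (v_{i+1} − v_i)·(w_0 + w̃_0')/2 + (v_i − v_{i−1})·(w_1 + w̃_1')/2. Consequently, if all four weights are nonnegative and v_{i+1} − v_i and v_i − v_{i−1} are both positive (respectively both negative), then v⁻_{i+1/2} − v⁺_{i−1/2} is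 positive (respectively negative); that is, the inner jump condition sign(v⁻_{i+1/2} − v⁺_{i−1/2}) = sign(Δv_{i+1/2}) = sign(Δv_{i−1/2}) holds automatically. -/
/-- **Inner jump condition.** With left reconstructed value
`v⁻_{i+1/2} = w₀·(vᵢ + vᵢ₊₁)/2 + w₁·(3vᵢ − vᵢ₋₁)/2` and right reconstructed value
`v⁺_{i−1/2} = w̃₀'·(3vᵢ − vᵢ₊₁)/2 + w̃₁'·(vᵢ₋₁ + vᵢ)/2`, where each pair of weights sums
to one, the identity
`v⁻_{i+1/2} − v⁺_{i−1/2} = (vᵢ₊₁ − vᵢ)·(w₀ + w̃₀')/2 + (vᵢ − vᵢ₋₁)·(w₁ + w̃₁')/2` holds;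
consequently, if all four weights are nonnegative and both cell-value jumps are positive
(resp. both negative), then the inner difference is positive (resp. negative). -/
theorem weno_inner_jump_condition
    (vim1 vi vip1 : ℝ) (w0 w1 wt0' wt1' : ℝ)
    (hw : w0 + w1 = 1) (hwt : wt0' + wt1' = 1)
    (vm vp : ℝ)
    (hvm : vm = w0 * (vi + vip1) / 2 + w1 * (3 * vi - vim1) / 2)
    (hvp : vp = wt0' * (3 * vi - vip1) / 2 + wt1' * (vim1 + vi) / 2) :
    vm - vp = (vip1 - vi) * (w0 + wt0') / 2 + (vi - vim1) * (w1 + wt1') / 2 ∧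
      (0 ≤ w0 → 0 ≤ w1 → 0 ≤ wt0' → 0 ≤ wt1' →
        ((0 < vip1 - vi → 0 < vi - vim1 → 0 < vm - vp) ∧
         (vip1 - vi < 0 → vi - vim1 < 0 → vm - vp < 0))) := by
  have identity :
      vm - vp = (vip1 - vi) * (w0 + wt0') / 2 + (vi - vim1) * (w1 + wt1') / 2 := by
    rw [hvm, hvp]
    linear_combination vi * hw - vi * hwt
  refine ⟨identity, fun h0 h1 ht0 ht1 => ?_⟩
  have combo :
      vm - vp = ((w0 + wt0') / 2) • (vip1 - vi) + ((w1 + wt1') / 2) • (vi - vim1) := by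
    rw [identity, smul_eq_mul, smul_eq_mul]
    ring
  have ha : 0 ≤ (w0 + wt0') / 2 := by positivity
  have hb : 0 ≤ (w1 + wt1') / 2 := by positivity
  have hab : (w0 + wt0') / 2 + (w1 + wt1') / 2 = 1 := by linarith
  rw [combo]
  exact ⟨fun hr hl => convex_Ioi (0 : ℝ) hr hl ha hb hab,
    fun hr hl => convex_Iio (0 : ℝ) hr hl ha hb hab⟩
end

section
/- Fix real numbers v_{i−1}, v_i, v_{i+1}, v_{i+2} with Δv_{i+1/2} := v_{i+1} − v_i ≠ 0, set θ⁺ := (v_i − v_{i−1})/Δv_{i+1/2}, θ⁻ := (v_{i+2} − v_{i+1})/Δv_{i+1/2}, and suppose θ⁺ ≠ 1 and A + B ≠ 0 where A := 1 − θ⁺ and B := 1 − θ⁻ (i.e., ψ⁺ := B/A ≠ −1). Let C_1, C_2 be reals satisfying the line condition 𝓛 = 1, i.e., C_1/((1/8)(1 + ψ⁺)) + C_2/((1/8)(1 + ψ⁻)) = 1 with ψ⁻ := A/B (equivalently 8·C_1·A + 8·C_2·B = A + B). Define the weights w_0 := 3/4 + 2C_1, w_1 := 1/4 − 2C_1, w̃_0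 := 1/4 − 2C_2, w̃_1 := 3/4 + 2C_2 and the reconstructed values v⁻ := w_0·(v_i + v_{i+1})/2 + w_1·(3v_i − v_{i−1})/2 and v⁺ := w̃_0·(3v_{i+1} − v_{i+2})/2 + w̃_1·(v_i + v_{i+1})/2. Then v⁻ = v⁺, i.e., the reconstructed jump ⟦v⟧ = v⁺ − v⁻ vanishes. -/
/-- If `(C₁, C₂)` lies on the line `𝓛 = 1`, i.e. (with `A = 1 − θ⁺`, `B = 1 − θ⁻`,
`ψ⁺ = B/A`, `ψ⁻ = A/B`) `C₁/((1/8)(1+ψ⁺)) + C₂/((1/8)(1+ψ⁻)) = 1`, equivalently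
`8·C₁·A + 8·C₂·B = A + B`, then the reconstructed interface values coincide:
`v⁻ = v⁺`, i.e. the reconstructed jump `⟦v⟧ = v⁺ − v⁻` vanishes. -/
theorem sp_weno_line_zero_jump
    (vim1 vi vip1 vip2 C₁ C₂ : ℝ)
    (Δv θp θm A B : ℝ)
    (hΔv : Δv = vip1 - vi) (hΔ : Δv ≠ 0)
    (hθp : θp = (vi - vim1) / Δv)
    (hθm : θm = (vip2 - vip1) / Δv)
    (hA : A = 1 - θp) (hB : B = 1 - θm)
    (hθp1 : θp ≠ 1) (hAB : A + B ≠ 0)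
    (hline : 8 * C₁ * A + 8 * C₂ * B = A + B)
    (w0 w1 wt0 wt1 vm vp : ℝ)
    (hw0 : w0 = 3/4 + 2*C₁) (hw1 : w1 = 1/4 - 2*C₁)
    (hwt0 : wt0 = 1/4 - 2*C₂) (hwt1 : wt1 = 3/4 + 2*C₂)
    (hvm : vm = w0 * (vi + vip1) / 2 + w1 * (3 * vi - vim1) / 2)
    (hvp : vp = wt0 * (3 * vip1 - vip2) / 2 + wt1 * (vi + vip1) / 2) :
    vm = vp := by
  have hp : vim1 = vi - θp * Δv := by rw [hθp]; field_simp; ring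
  have hm : vip2 = vip1 + θm * Δv := by rw [hθm]; field_simp; ring
  have hv : vip1 = vi + Δv := by rw [hΔv]; ring
  rw [hvm, hvp, hw0, hw1, hwt0, hwt1, hm, hp, hv]
  rw [hA, hB] at hline
  linear_combination Δv / 8 * hline
end

section
/- Let ψ⁺ be a real number with ψ⁺ < 0 and ψ⁺ ≠ −1, and set ψ⁻ := 1/ψ⁺, f⁺ := 1/(1 + ψ⁺), f⁻ := 1/(1 + ψ⁻). Define C_1 := (1/8)·f⁺/((f⁺)² + (f⁻)²) and C_2 := (1/8)·f⁻/((f⁺)² + (f⁻)²). Then −3/8 ≤ C_1 ≤ 1/8 and −3/8 ≤ C_2 ≤ 1/8; that is, the explicit SP-WENO parameters satisfy the consistency condition (P1′), so the corresponding weights w_0 = 3/4 + 2C_1, w_1 = 1/4 − 2C_1, w̃_0 = 1/4 − 2C_2, w̃_1 = 3/4 + 2C_2 all lie in [0,1]. -/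
theorem div_sq_add_sq_bounds {a b : ℝ} (hsum : a + b = 1) (hprod : a * b ≤ 0) :
    -3/8 ≤ (1/8) * a / (a^2 + b^2) ∧ (1/8) * a / (a^2 + b^2) ≤ 1/8 := by
  obtain rfl : b = 1 - a := by linarith
  have hpos : 0 < a^2 + (1 - a)^2 := by nlinarith [sq_nonneg (2 * a - 1)]
  rw [le_div_iff₀ hpos, div_le_iff₀ hpos]
  constructor
  · nlinarith [sq_nonneg (12 * a - 5)]
  · nlinarith [sq_nonneg (1 - a)]

/-- The explicit SP-WENO parameters `C₁ = (1/8)·f⁺/((f⁺)² + (f⁻)²)` and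
`C₂ = (1/8)·f⁻/((f⁺)² + (f⁻)²)` (with `ψ⁺ < 0`, `ψ⁺ ≠ −1`, `ψ⁻ = 1/ψ⁺`,
`f⁺ = 1/(1+ψ⁺)`, `f⁻ = 1/(1+ψ⁻)`) satisfy the consistency condition (P1′):
`−3/8 ≤ C₁ ≤ 1/8` and `−3/8 ≤ C₂ ≤ 1/8`, so the corresponding WENO weights
`w₀ = 3/4 + 2C₁, w₁ = 1/4 − 2C₁, w̃₀ = 1/4 − 2C₂, w̃₁ = 3/4 + 2C₂` all lie in `[0,1]`. -/
theorem sp_weno_explicit_consistency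
    (ψp : ℝ) (hψ0 : ψp < 0) (hψ1 : ψp ≠ -1)
    (ψm fp fm C₁ C₂ : ℝ)
    (hψm : ψm = 1 / ψp)
    (hfp : fp = 1 / (1 + ψp)) (hfm : fm = 1 / (1 + ψm))
    (hC₁ : C₁ = (1/8) * fp / (fp^2 + fm^2))
    (hC₂ : C₂ = (1/8) * fm / (fp^2 + fm^2)) :
    (-3/8 ≤ C₁ ∧ C₁ ≤ 1/8) ∧ (-3/8 ≤ C₂ ∧ C₂ ≤ 1/8) := by
  have hne : 1 + ψp ≠ 0 := fun h => hψ1 (by linarith)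
  have hfm' : fm = ψp / (1 + ψp) := by
    have hinv : 1 + ψm = (1 + ψp) / ψp := by
      rw [hψm]
      field_simp [hψ0.ne]
      ring
    rw [hfm, hinv, one_div_div]
  have hsum : fp + fm = 1 := by
    rw [hfp, hfm', ← add_div, div_self hne]
  have hprod : fp * fm ≤ 0 := by
    rw [hfp, hfm', div_mul_div_comm, one_mul]
    exact div_nonpos_of_nonpos_of_nonneg hψ0.le (mul_self_nonneg _)
  rw [hC₁, hC₂]
  refine ⟨div_sq_add_sq_bounds hsum hprod, ?_⟩
  rw [add_comm (fp^2)]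
  exact div_sq_add_sq_bounds (by rwa [add_comm]) (by rwa [mul_comm])
end

section
/- Let a, b, c be real numbers with b ≠ 0, representing the consecutive cell-value jumps Δv_{i−1/2}, Δv_{i+1/2}, Δv_{i+3/2}, and set θ⁺ := a/b and θ⁻ := c/b. Define the SP-WENO reconstructed jump J by: J = 0 if (θ⁺ > 1 and θ⁻ > 1) or (θ⁺ < 1 and θ⁻ > 1) or (θ⁺ > 1 and θ⁻ < 1) or (|θ⁺| > 1 and θ⁻ = 1) or (θ⁺ = 1 and |θ⁻| > 1) or (θ⁺ < −1 and θ⁻ < −1); J = (b − a)/2 if (|θ⁺| ≤ 1 and θ⁻ = 1) or (−1 ≤ θ⁺ < 1 and θ⁻ < −1); J = (b − c)/2 if (θ⁺ = 1 and |θ⁻| ≤ 1) or (θ⁺ < −1 and −1 ≤ θ⁻ < 1); and J = b − (a + c)/2 if (−1 ≤ θ⁺ < 1 and −1 ≤ θ⁻ < 1). Then |J| ≤ 2·|b|; that is, the jump in the SP-WENO reconstruction is bounded by twice the jump in the underlying cell values. -/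
/-- **Stability bound for SP-WENO.** Let `a, b, c` denote the consecutive cell-value jumps
`Δv_{i−1/2}, Δv_{i+1/2}, Δv_{i+3/2}` with `b ≠ 0`, and set `θ⁺ = a/b`, `θ⁻ = c/b`.  The
SP-WENO reconstructed jump `J`, given by the explicit piecewise case table partitioning the
`(θ⁺, θ⁻)`-plane into the regions `Ω₀` (zero jump), `Ω₁` (jump `(b − a)/2`), `Ω₂`
(jump `(b − c)/2`) and `Ω₃` (jump `b − (a + c)/2`), satisfies `|J| ≤ 2·|b|`. -/
theorem sp_weno_jump_bound
    (a b c : ℝ) (hb : b ≠ 0)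
    (θp θm J : ℝ) (hθp : θp = a / b) (hθm : θm = c / b)
    (hΩ0 : ((θp > 1 ∧ θm > 1) ∨ (θp < 1 ∧ θm > 1) ∨ (θp > 1 ∧ θm < 1) ∨
            (|θp| > 1 ∧ θm = 1) ∨ (θp = 1 ∧ |θm| > 1) ∨ (θp < -1 ∧ θm < -1)) → J = 0)
    (hΩ1 : ((|θp| ≤ 1 ∧ θm = 1) ∨ (-1 ≤ θp ∧ θp < 1 ∧ θm < -1)) → J = (b - a) / 2)
    (hΩ2 : ((θp = 1 ∧ |θm| ≤ 1) ∨ (θp < -1 ∧ -1 ≤ θm ∧ θm < 1)) → J = (b - c) / 2)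
    (hΩ3 : ((-1 ≤ θp ∧ θp < 1) ∧ (-1 ≤ θm ∧ θm < 1)) → J = b - (a + c) / 2) :
    |J| ≤ 2 * |b| := by
  have ha : a = θp * b := by rw [hθp, div_mul_cancel₀ a hb]
  have hc : c = θm * b := by rw [hθm, div_mul_cancel₀ c hb]
  clear hθp hθm
  simp only [abs_le, lt_abs, gt_iff_lt] at hΩ0 hΩ1 hΩ2
  suffices h : ∃ t : ℝ, J = t * b ∧ |t| ≤ 2 by
    obtain ⟨t, rfl, ht⟩ := h
    rw [abs_mul]
    exact mul_le_mul_of_nonneg_right ht (abs_nonneg b)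
  have of_zero (h : J = 0) : ∃ t : ℝ, J = t * b ∧ |t| ≤ 2 := ⟨0, by simp [h]⟩
  have of_left (h : J = (b - a) / 2) (h₁ : -1 ≤ θp) (h₂ : θp ≤ 1) :
      ∃ t : ℝ, J = t * b ∧ |t| ≤ 2 :=
    ⟨(1 - θp) / 2, by rw [h, ha]; ring, by rw [abs_le]; constructor <;> linarith⟩
  have of_right (h : J = (b - c) / 2) (h₁ : -1 ≤ θm) (h₂ : θm ≤ 1) :
      ∃ t : ℝ, J = t * b ∧ |t| ≤ 2 :=
    ⟨(1 - θm) / 2, by rw [h, hc]; ring, by rw [abs_le]; constructor <;> linarith⟩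
  have of_both (h : J = b - (a + c) / 2) (h₁ : -1 ≤ θp) (h₂ : θp ≤ 1) (h₃ : -1 ≤ θm)
      (h₄ : θm ≤ 1) : ∃ t : ℝ, J = t * b ∧ |t| ≤ 2 :=
    ⟨1 - (θp + θm) / 2, by rw [h, ha, hc]; ring, by rw [abs_le]; constructor <;> linarith⟩
  generalize (∃ t : ℝ, J = t * b ∧ |t| ≤ 2) = P at *
  rcases lt_trichotomy θp 1 with hp | hp | hp <;> rcases lt_trichotomy θm 1 with hm | hm | hm <;>
    rcases lt_or_ge θp (-1) with hp' | hp' <;> rcases lt_or_ge θm (-1) with hm' | hm' <;> grind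
end

section
/- Let a, b, c be real numbers with b ≠ 0, set θ⁺ := a/b and θ⁻ := c/b, and define the SP-WENO reconstructed jump J by: J = 0 if (θ⁺ > 1 and θ⁻ > 1) or (θ⁺ < 1 and θ⁻ > 1) or (θ⁺ > 1 and θ⁻ < 1) or (|θ⁺| > 1 and θ⁻ = 1) or (θ⁺ = 1 and |θ⁻| > 1) or (θ⁺ < −1 and θ⁻ < −1); J = (b − a)/2 if (|θ⁺| ≤ 1 and θ⁻ = 1) or (−1 ≤ θ⁺ < 1 and θ⁻ < −1); J = (b − c)/2 if (θ⁺ = 1 and |θ⁻| ≤ 1) or (θ⁺ < −1 and −1 ≤ θ⁻ < 1); and J = b − (a + c)/2 if (−1 ≤ θ⁺ < 1 and −1 ≤ θ⁻ < 1). Then J·b ≥ 0; that is, the SP-WENO reconstruction satisfies the sign property: the reconstructed jump has the same sign as the cell-value jump b = Δv_{i+1/2}. -/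
/-- **Sign property of SP-WENO.** Let `a, b, c` denote the consecutive cell-value jumps
`Δv_{i−1/2}, Δv_{i+1/2}, Δv_{i+3/2}` with `b ≠ 0`, and set `θ⁺ = a/b`, `θ⁻ = c/b`.  The
SP-WENO reconstructed jump `J`, given by the explicit piecewise case table partitioning the
`(θ⁺, θ⁻)`-plane into the regions `Ω₀` (zero jump), `Ω₁` (jump `(b − a)/2`), `Ω₂`
(jump `(b − c)/2`) and `Ω₃` (jump `b − (a + c)/2`), satisfies `J·b ≥ 0`: the reconstructed
jump has the same sign as the cell-value jump `b = Δv_{i+1/2}`. -/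
theorem sp_weno_sign_property
    (a b c : ℝ) (hb : b ≠ 0)
    (θp θm J : ℝ) (hθp : θp = a / b) (hθm : θm = c / b)
    (hΩ0 : ((θp > 1 ∧ θm > 1) ∨ (θp < 1 ∧ θm > 1) ∨ (θp > 1 ∧ θm < 1) ∨
            (|θp| > 1 ∧ θm = 1) ∨ (θp = 1 ∧ |θm| > 1) ∨ (θp < -1 ∧ θm < -1)) → J = 0)
    (hΩ1 : ((|θp| ≤ 1 ∧ θm = 1) ∨ (-1 ≤ θp ∧ θp < 1 ∧ θm < -1)) → J = (b - a) / 2)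
    (hΩ2 : ((θp = 1 ∧ |θm| ≤ 1) ∨ (θp < -1 ∧ -1 ≤ θm ∧ θm < 1)) → J = (b - c) / 2)
    (hΩ3 : ((-1 ≤ θp ∧ θp < 1) ∧ (-1 ≤ θm ∧ θm < 1)) → J = b - (a + c) / 2) :
    J * b ≥ 0 := by
  have ha : a = θp * b := by rw [hθp, div_mul_cancel₀ a hb]
  have hc : c = θm * b := by rw [hθm, div_mul_cancel₀ c hb]
  clear hθp hθm
  subst ha hc
  suffices h : ∃ t : ℝ, 0 ≤ t ∧ J = t * b by
    obtain ⟨t, ht, rfl⟩ := h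
    rw [mul_assoc]
    exact mul_nonneg ht (mul_self_nonneg b)
  have zero_jump (h : J = 0) : ∃ t : ℝ, 0 ≤ t ∧ J = t * b := ⟨0, le_rfl, by simp [h]⟩
  have left_jump (hp : θp ≤ 1) (h : J = (b - θp * b) / 2) : ∃ t : ℝ, 0 ≤ t ∧ J = t * b :=
    ⟨(1 - θp) / 2, by linarith, by rw [h]; ring⟩
  have right_jump (hm : θm ≤ 1) (h : J = (b - θm * b) / 2) : ∃ t : ℝ, 0 ≤ t ∧ J = t * b :=
    ⟨(1 - θm) / 2, by linarith, by rw [h]; ring⟩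
  have full_jump (hp : θp ≤ 1) (hm : θm ≤ 1) (h : J = b - (θp * b + θm * b) / 2) :
      ∃ t : ℝ, 0 ≤ t ∧ J = t * b :=
    ⟨1 - (θp + θm) / 2, by linarith, by rw [h]; ring⟩
  rcases lt_trichotomy θm 1 with hm | hm | hm
  · rcases lt_trichotomy θp 1 with hp | hp | hp
    · rcases lt_or_ge θp (-1) with hp' | hp' <;> rcases lt_or_ge θm (-1) with hm' | hm'
      · exact zero_jump (hΩ0 (.inr (.inr (.inr (.inr (.inr ⟨hp', hm'⟩))))))
      · exact right_jump hm.le (hΩ2 (.inr ⟨hp', hm', hm⟩))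
      · exact left_jump hp.le (hΩ1 (.inr ⟨hp', hp, hm'⟩))
      · exact full_jump hp.le hm.le (hΩ3 ⟨⟨hp', hp⟩, hm', hm⟩)
    · rcases lt_or_ge 1 |θm| with hm' | hm'
      · exact zero_jump (hΩ0 (.inr (.inr (.inr (.inr (.inl ⟨hp, hm'⟩))))))
      · exact right_jump hm.le (hΩ2 (.inl ⟨hp, hm'⟩))
    · exact zero_jump (hΩ0 (.inr (.inr (.inl ⟨hp, hm⟩))))
  · rcases lt_or_ge 1 |θp| with hp | hp
    · exact zero_jump (hΩ0 (.inr (.inr (.inr (.inl ⟨hp, hm⟩)))))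
    · exact left_jump (le_of_abs_le hp) (hΩ1 (.inl ⟨hp, hm⟩))
  · rcases lt_trichotomy θp 1 with hp | hp | hp
    · exact zero_jump (hΩ0 (.inr (.inl ⟨hp, hm⟩)))
    · have hm' : |θm| > 1 := hm.trans_le (le_abs_self θm)
      exact zero_jump (hΩ0 (.inr (.inr (.inr (.inr (.inl ⟨hp, hm'⟩))))))
    · exact zero_jump (hΩ0 (.inl ⟨hp, hm⟩))
end

section
/- Let v : ℝ → ℝ be three times continuously differentiable, let x ∈ ℝ, and let C : ℝ → ℝ satisfy C(h) = O(h) as h → 0. Define the weights w_0(h) := 3/4 + 2C(h) and w_1(h) := 1/4 − 2C(h). Then the weighted third-order WENO left reconstruction at the interface x + h/2 is third-order accurate: w_0(h)·(v(x) + v(x+h))/2 + w_1(h)·(3v(x) − v(x−h))/2 − v(x + h/2) = O(h³) as h → 0. (In particular, the two second-order stencil values satisfy (v(x) + v(x+h))/2 = v(x+h/2) + (h²/8)·v″(x+h/2) + O(h³) and (3v(x) − v(x−h))/2 = v(x+h/2) − (3h²/8)·v″(x+h/2) + O(h³), so the quadratic error terms cancel to order h³ whenever C(h) = O(h).) -/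
open Asymptotics Filter

/-- A `C³` function agrees with a quadratic polynomial near each point, up to a cubic error. -/
theorem exists_quadratic_sub_isBigO_cube {v : ℝ → ℝ} (hv : ContDiff ℝ 3 v) (x : ℝ) :
    ∃ b c : ℝ, (fun t : ℝ => v (x + t) - (v x + b * t + c * t ^ 2))
      =O[nhds (0 : ℝ)] fun t => t ^ 3 := by
  have hshift : Tendsto (fun t : ℝ => x + t) (nhds 0) (nhds x) :=
    Continuous.tendsto' (by fun_prop) _ _ (add_zero x)
  have htaylor := ((taylor_isLittleO_univ (n := 3) (x₀ := x) hv).comp_tendsto hshift).isBigO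
  simp only [Function.comp_def, taylorWithinEval_succ, taylor_within_zero_eval,
    add_sub_cancel_left, smul_eq_mul] at htaylor
  have hcube := (isBigO_refl (fun t : ℝ => t ^ 3) (nhds 0)).const_mul_left
    (iteratedDerivWithin 3 v Set.univ x / 6)
  refine ⟨iteratedDerivWithin 1 v Set.univ x, iteratedDerivWithin 2 v Set.univ x / 2,
    (htaylor.add hcube).congr_left fun t => ?_⟩
  norm_num [Nat.factorial]
  ring

/-- **Third-order accuracy of the weighted WENO left reconstruction.** If `v` is three
times continuously differentiable and the accuracy parameter satisfies `C(h) = O(h)` as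
`h → 0`, then with weights `w₀(h) = 3/4 + 2C(h)` and `w₁(h) = 1/4 − 2C(h)`, the weighted
reconstruction at the interface `x + h/2` is third-order accurate:
`w₀(h)·(v(x) + v(x+h))/2 + w₁(h)·(3v(x) − v(x−h))/2 − v(x + h/2) = O(h³)` as `h → 0`. -/
theorem weno_third_order_accuracy
    (v : ℝ → ℝ) (hv : ContDiff ℝ 3 v) (x : ℝ)
    (C : ℝ → ℝ) (hC : C =O[nhds (0:ℝ)] fun h => h) :
    (fun h : ℝ => (3/4 + 2 * C h) * ((v x + v (x + h)) / 2) +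
        (1/4 - 2 * C h) * ((3 * v x - v (x - h)) / 2) - v (x + h / 2))
      =O[nhds (0:ℝ)] fun h => h ^ 3 := by
  obtain ⟨b, c, hR⟩ := exists_quadratic_sub_isBigO_cube hv x
  have hscale (k : ℝ) : (fun h : ℝ => v (x + k * h) - (v x + b * (k * h) + c * (k * h) ^ 2))
      =O[nhds (0 : ℝ)] fun h => h ^ 3 := by
    have hk : Tendsto (fun h : ℝ => k * h) (nhds 0) (nhds 0) :=
      Continuous.tendsto' (by fun_prop) _ _ (mul_zero k)
    refine (hR.comp_tendsto hk).trans ?_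
    simpa only [Function.comp_def, mul_pow] using
      (isBigO_refl (fun h : ℝ => h ^ 3) (nhds 0)).const_mul_left (k ^ 3)
  have hCone : C =O[nhds (0 : ℝ)] fun _ => (1 : ℝ) :=
    hC.trans ((continuous_id.tendsto (0 : ℝ)).isBigO_one ℝ)
  have hweight (p q : ℝ) : (fun h => p + q * C h) =O[nhds (0 : ℝ)] fun _ => (1 : ℝ) :=
    (isBigO_const_const p one_ne_zero _).add (hCone.const_mul_left q)
  have hquad : (fun h => 2 * c * (C h * h ^ 2)) =O[nhds (0 : ℝ)] fun h => h ^ 3 :=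
    ((hC.mul (isBigO_refl (fun h : ℝ => h ^ 2) _)).const_mul_left (2 * c)).congr_right
      fun h => by ring
  have hcent := ((hweight (3 / 8) 1).mul (hscale 1)).congr_right fun h => one_mul (h ^ 3)
  have hleft := ((hweight (1 / 8) (-1)).mul (hscale (-1))).congr_right fun h => one_mul (h ^ 3)
  refine (((hquad.add hcent).sub hleft).sub (hscale (1 / 2))).congr_left fun h => ?_
  rw [show x + 1 * h = x + h by ring, show x + -1 * h = x - h by ring,
    show x + 1 / 2 * h = x + h / 2 by ring]
  ring
end
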